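/- Let w : ℝ × ℝ → ℝ be a smooth nowhere-zero function such that v := w_x / w satisfies the mKdV equation v_t = v_xxx − 6 v² v_x at every point. Then the x-derivative of the function (w_t − w_xxx + 3 w_x w_xx / w)/w vanishes identically; equivalently, (w_t / w)_x = (w_xxx / w − 3 w_x w_xx / w²)_x at every point. -/

import Mathlib

/-- Partial derivative with respect to the first (space) variable. -/
noncomputable def px (f : ℝ × ℝ → ℝ) : ℝ × ℝ → ℝ :=
  fun p => deriv (fun x => f (x, p.2)) p.1

/-- Partial derivative with respect to the second (time) variable. -/
noncomputable def pt (f : ℝ × ℝ → ℝ) : ℝ × ℝ → ℝ :=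
  fun p => deriv (fun t => f (p.1, t)) p.2

section PartialDerivatives

variable {f g : ℝ × ℝ → ℝ}

lemma hasDerivAt_fst_slice (hf : Differentiable ℝ f) (p : ℝ × ℝ) :
    HasDerivAt (fun x => f (x, p.2)) (fderiv ℝ f p (1, 0)) p.1 :=
  (hf p).hasFDerivAt.comp_hasDerivAt (f := fun x => (x, p.2)) p.1
    ((hasDerivAt_id p.1).prodMk (hasDerivAt_const p.1 p.2))

lemma hasDerivAt_snd_slice (hf : Differentiable ℝ f) (p : ℝ × ℝ) :
    HasDerivAt (fun t => f (p.1, t)) (fderiv ℝ f p (0, 1)) p.2 :=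
  (hf p).hasFDerivAt.comp_hasDerivAt (f := fun t => (p.1, t)) p.2
    ((hasDerivAt_const p.2 p.1).prodMk (hasDerivAt_id p.2))

lemma px_eq_fderiv (hf : Differentiable ℝ f) : px f = fun p => fderiv ℝ f p (1, 0) :=
  funext fun p => (hasDerivAt_fst_slice hf p).deriv

lemma pt_eq_fderiv (hf : Differentiable ℝ f) : pt f = fun p => fderiv ℝ f p (0, 1) :=
  funext fun p => (hasDerivAt_snd_slice hf p).deriv

lemma hasDerivAt_px (hf : Differentiable ℝ f) (p : ℝ × ℝ) :
    HasDerivAt (fun x => f (x, p.2)) (px f p) p.1 :=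
  (hasDerivAt_fst_slice hf p).differentiableAt.hasDerivAt

lemma hasDerivAt_pt (hf : Differentiable ℝ f) (p : ℝ × ℝ) :
    HasDerivAt (fun t => f (p.1, t)) (pt f p) p.2 :=
  (hasDerivAt_snd_slice hf p).differentiableAt.hasDerivAt

lemma ContDiff.differentiable_of_smooth (hf : ContDiff ℝ (⊤ : ℕ∞) f) : Differentiable ℝ f :=
  hf.differentiable (by simp)

lemma ContDiff.px (hf : ContDiff ℝ (⊤ : ℕ∞) f) : ContDiff ℝ (⊤ : ℕ∞) (px f) := by
  rw [px_eq_fderiv hf.differentiable_of_smooth]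
  exact (hf.fderiv_right (by simp)).clm_apply contDiff_const

lemma ContDiff.pt (hf : ContDiff ℝ (⊤ : ℕ∞) f) : ContDiff ℝ (⊤ : ℕ∞) (pt f) := by
  rw [pt_eq_fderiv hf.differentiable_of_smooth]
  exact (hf.fderiv_right (by simp)).clm_apply contDiff_const

lemma px_pt_comm (hf : ContDiff ℝ (⊤ : ℕ∞) f) : px (pt f) = pt (px f) := by
  have hd : Differentiable ℝ (fderiv ℝ f) :=
    (hf.fderiv_right (m := (⊤ : ℕ∞)) (by simp)).differentiable (by simp)
  rw [px_eq_fderiv hf.pt.differentiable_of_smooth, pt_eq_fderiv hf.px.differentiable_of_smooth,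
    px_eq_fderiv hf.differentiable_of_smooth, pt_eq_fderiv hf.differentiable_of_smooth]
  funext p
  have hs : IsSymmSndFDerivAt ℝ f p := hf.contDiffAt.isSymmSndFDerivAt (by
    rw [minSmoothness_of_isRCLikeNormedField]
    exact WithTop.coe_le_coe.2 (le_top : (2 : ℕ∞) ≤ ⊤))
  rw [fderiv_clm_apply (hd p) (differentiableAt_const _),
    fderiv_clm_apply (hd p) (differentiableAt_const _)]
  simpa using hs.eq (1, 0) (0, 1)

lemma px_sub (hf : Differentiable ℝ f) (hg : Differentiable ℝ g) (p : ℝ × ℝ) :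
    px (fun q => f q - g q) p = px f p - px g p :=
  ((hasDerivAt_px hf p).fun_sub (hasDerivAt_px hg p)).deriv

lemma px_div (hf : Differentiable ℝ f) (hg : Differentiable ℝ g) (p : ℝ × ℝ) (h0 : g p ≠ 0) :
    px (fun q => f q / g q) p = (px f p * g p - f p * px g p) / g p ^ 2 :=
  ((hasDerivAt_px hf p).fun_div (hasDerivAt_px hg p) h0).deriv

lemma pt_div (hf : Differentiable ℝ f) (hg : Differentiable ℝ g) (p : ℝ × ℝ) (h0 : g p ≠ 0) :
    pt (fun q => f q / g q) p = (pt f p * g p - f p * pt g p) / g p ^ 2 :=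
  ((hasDerivAt_pt hf p).fun_div (hasDerivAt_pt hg p) h0).deriv

lemma px_pow (hf : Differentiable ℝ f) (n : ℕ) (p : ℝ × ℝ) :
    px (fun q => f q ^ n) p = n * f p ^ (n - 1) * px f p :=
  ((hasDerivAt_px hf p).fun_pow n).deriv

lemma px_const_mul (c : ℝ) (hf : Differentiable ℝ f) (p : ℝ × ℝ) :
    px (fun q => c * f q) p = c * px f p :=
  ((hasDerivAt_px hf p).const_mul c).deriv

end PartialDerivatives

section LogarithmicDerivative

variable {w : ℝ × ℝ → ℝ}

lemma pt_px_div_self (hw : ContDiff ℝ (⊤ : ℕ∞) w) (p : ℝ × ℝ) (h0 : w p ≠ 0) :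
    pt (fun q => px w q / w q) p = px (fun q => pt w q / w q) p := by
  have hd := hw.differentiable_of_smooth
  rw [pt_div hw.px.differentiable_of_smooth hd p h0,
    px_div hw.pt.differentiable_of_smooth hd p h0, px_pt_comm hw]
  ring

lemma px_px_div_self (hw : ContDiff ℝ (⊤ : ℕ∞) w) (hw0 : ∀ p, w p ≠ 0) :
    px (fun q => px w q / w q) = fun q => px (px w) q / w q - (px w q / w q) ^ 2 := by
  funext p
  have h0 := hw0 p
  rw [px_div hw.px.differentiable_of_smooth hw.differentiable_of_smooth p h0]
  field_simp

lemma px_px_px_div_self (hw : ContDiff ℝ (⊤ : ℕ∞) w) (hw0 : ∀ p, w p ≠ 0) (p : ℝ × ℝ) :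
    px (px (fun q => px w q / w q)) p =
      px (px (px w)) p / w p - 3 * px w p * px (px w) p / w p ^ 2 + 2 * (px w p / w p) ^ 3 := by
  have h0 := hw0 p
  have hd := hw.differentiable_of_smooth
  have hv : Differentiable ℝ fun q => px w q / w q :=
    (hw.px.div hw hw0).differentiable_of_smooth
  have hu : Differentiable ℝ fun q => px (px w) q / w q :=
    (hw.px.px.div hw hw0).differentiable_of_smooth
  rw [px_px_div_self hw hw0, px_sub hu (hv.fun_pow 2), px_pow hv 2,
    px_div hw.px.px.differentiable_of_smooth hd p h0,
    px_div hw.px.differentiable_of_smooth hd p h0]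
  simp only [Nat.cast_ofNat, Nat.reduceSub, pow_one]
  field_simp
  ring

end LogarithmicDerivative

/-- If `w` is smooth, nowhere zero, and `v := w_x / w` satisfies the mKdV equation,
then `(w_t / w)_x = (w_xxx / w - 3 w_x w_xx / w²)_x` at every point. -/
theorem mkdv_to_kdvEigenfunction_up_to_x_derivative
    (w : ℝ × ℝ → ℝ) (hw : ContDiff ℝ (⊤ : ℕ∞) w) (hw0 : ∀ p, w p ≠ 0)
    (hmkdv : ∀ p, pt (fun q => px w q / w q) p =
      px (px (px (fun q => px w q / w q))) p -
        6 * (px w p / w p) ^ 2 * px (fun q => px w q / w q) p) :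
    (∀ p, px (fun q => (pt w q - px (px (px w)) q + 3 * px w q * px (px w) q / w q) / w q) p
        = 0) ∧
    (∀ p, px (fun q => pt w q / w q) p =
        px (fun q => px (px (px w)) q / w q - 3 * px w q * px (px w) q / (w q) ^ 2) p) := by
  have hv : ContDiff ℝ (⊤ : ℕ∞) fun q => px w q / w q := hw.px.div hw hw0
  have ha : ContDiff ℝ (⊤ : ℕ∞) fun q => pt w q / w q := hw.pt.div hw hw0
  have hb : ContDiff ℝ (⊤ : ℕ∞)
      fun q => px (px (px w)) q / w q - 3 * px w q * px (px w) q / (w q) ^ 2 :=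
    (hw.px.px.px.div hw hw0).sub
      (((contDiff_const.mul hw.px).mul hw.px.px).div (hw.pow 2) fun p => pow_ne_zero 2 (hw0 p))
  have main : ∀ p, px (fun q => pt w q / w q) p =
      px (fun q => px (px (px w)) q / w q - 3 * px w q * px (px w) q / (w q) ^ 2) p := by
    intro p
    have hflux : (fun q => px (px (px w)) q / w q - 3 * px w q * px (px w) q / (w q) ^ 2) =
        fun q => px (px (fun q => px w q / w q)) q - 2 * (px w q / w q) ^ 3 := by
      funext q
      rw [px_px_px_div_self hw hw0]
      ring
    have hv3 := hv.differentiable_of_smooth.fun_pow 3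
    rw [← pt_px_div_self hw p (hw0 p), hmkdv, hflux,
      px_sub hv.px.px.differentiable_of_smooth (hv3.const_mul 2), px_const_mul 2 hv3,
      px_pow hv.differentiable_of_smooth 3]
    push_cast
    ring
  refine ⟨fun p => ?_, main⟩
  have hsplit : (fun q => (pt w q - px (px (px w)) q + 3 * px w q * px (px w) q / w q) / w q) =
      fun q => pt w q / w q -
        (px (px (px w)) q / w q - 3 * px w q * px (px w) q / (w q) ^ 2) := by
    funext q
    have h0 := hw0 q
    field_simp
    ring
  rw [hsplit, px_sub ha.differentiable_of_smooth hb.differentiable_of_smooth, main, sub_self]
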